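/- arXiv:2309.15870 — 4 statements merged into one kernel-verified Lean document; each statement's English description precedes it below -/
import Mathlib

section
/- Let n ≥ 1, let A and B be nonnegative n×n real matrices, and let (x*, y*) be a Nash equilibrium of the SRUC game (A, B) such that both x* and y* have full support (all entries strictly positive). Then, writing ρ_A := (x*ᵀAy*)/(x*ᵀy*) and ρ_B := (x*ᵀBy*)/(x*ᵀy*) (the equilibrium score and cost, which are finite real numbers), we have Bᵀx* = ρ_B x* and Ay* = ρ_A y*; that is, (ρ_B, x*) is an eigenpair of Bᵀ and (ρ_A, y*) is an eigenpair of A. -/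
open Finset

/-- Inner product `xᵀy`. -/
noncomputable def dotp {n : ℕ} (x y : Fin n → ℝ) : ℝ := ∑ i, x i * y i

/-- Bilinear form `xᵀCy`. -/
noncomputable def quadForm {n : ℕ} (C : Matrix (Fin n) (Fin n) ℝ) (x y : Fin n → ℝ) : ℝ :=
  ∑ i, ∑ j, x i * C i j * y j

/-- The SRUC payoff `e^C(x,y) ∈ [0,∞]`. -/
noncomputable def payoff {n : ℕ} (C : Matrix (Fin n) (Fin n) ℝ) (x y : Fin n → ℝ) : ENNReal :=
  if 0 < dotp x y then ENNReal.ofReal (quadForm C x y / dotp x y)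
  else if 0 < quadForm C x y then ⊤ else 0

/-- The standard simplex `Δ_n`. -/
def simplex (n : ℕ) : Set (Fin n → ℝ) := {x | (∀ i, 0 ≤ x i) ∧ ∑ i, x i = 1}

/-- Nash equilibrium of the SRUC game `(A, B)`. -/
def IsNash {n : ℕ} (A B : Matrix (Fin n) (Fin n) ℝ) (xs ys : Fin n → ℝ) : Prop :=
  xs ∈ simplex n ∧ ys ∈ simplex n ∧
  (∀ x ∈ simplex n, payoff A x ys ≤ payoff A xs ys) ∧
  (∀ y ∈ simplex n, payoff B xs ys ≤ payoff B xs y)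

/-- `C` is irreducible: `graph(C)` (edges `(i,j)` with `i ≠ j`, `C i j > 0`) is
strongly connected. -/
def MatIrreducible {n : ℕ} (C : Matrix (Fin n) (Fin n) ℝ) : Prop :=
  ∀ i j : Fin n, Relation.ReflTransGen (fun a b => a ≠ b ∧ 0 < C a b) i j

theorem dotp_single_left {n : ℕ} (i : Fin n) (y : Fin n → ℝ) :
    dotp (Pi.single i 1) y = y i := by
  simp [dotp, Pi.single_apply]

theorem dotp_single_right {n : ℕ} (x : Fin n → ℝ) (j : Fin n) :
    dotp x (Pi.single j 1) = x j := by
  simp [dotp, Pi.single_apply]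

theorem quadForm_eq_sum_mulVec {n : ℕ} (C : Matrix (Fin n) (Fin n) ℝ) (x y : Fin n → ℝ) :
    quadForm C x y = ∑ i, x i * C.mulVec y i := by
  simp [quadForm, Matrix.mulVec, dotProduct, Finset.mul_sum, mul_assoc]

theorem quadForm_eq_sum_transpose_mulVec {n : ℕ} (C : Matrix (Fin n) (Fin n) ℝ)
    (x y : Fin n → ℝ) :
    quadForm C x y = ∑ j, C.transpose.mulVec x j * y j := by
  rw [quadForm, Finset.sum_comm]
  refine Finset.sum_congr rfl fun j _ => ?_
  simp [Matrix.mulVec, dotProduct, Finset.sum_mul, mul_comm (x _)]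

theorem quadForm_single_left {n : ℕ} (C : Matrix (Fin n) (Fin n) ℝ) (i : Fin n)
    (y : Fin n → ℝ) : quadForm C (Pi.single i 1) y = C.mulVec y i := by
  simp [quadForm_eq_sum_mulVec, Pi.single_apply]

theorem quadForm_single_right {n : ℕ} (C : Matrix (Fin n) (Fin n) ℝ) (x : Fin n → ℝ)
    (j : Fin n) : quadForm C x (Pi.single j 1) = C.transpose.mulVec x j := by
  simp [quadForm_eq_sum_transpose_mulVec, Pi.single_apply]

theorem single_mem_simplex {n : ℕ} (i : Fin n) : (Pi.single i 1 : Fin n → ℝ) ∈ simplex n := by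
  refine ⟨fun j => ?_, by simp [Pi.single_apply]⟩
  rw [Pi.single_apply]
  split_ifs <;> norm_num

theorem quadForm_nonneg {n : ℕ} {C : Matrix (Fin n) (Fin n) ℝ} (hC : ∀ i j, 0 ≤ C i j)
    {x y : Fin n → ℝ} (hx : ∀ i, 0 ≤ x i) (hy : ∀ i, 0 ≤ y i) : 0 ≤ quadForm C x y :=
  Finset.sum_nonneg fun i _ => Finset.sum_nonneg fun j _ =>
    mul_nonneg (mul_nonneg (hx i) (hC i j)) (hy j)

theorem div_le_div_of_payoff_le {n : ℕ} {C : Matrix (Fin n) (Fin n) ℝ}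
    (hC : ∀ i j, 0 ≤ C i j) {x y x' y' : Fin n → ℝ} (hx' : ∀ i, 0 ≤ x' i)
    (hy' : ∀ i, 0 ≤ y' i) (hd : 0 < dotp x y) (hd' : 0 < dotp x' y')
    (h : payoff C x y ≤ payoff C x' y') :
    quadForm C x y / dotp x y ≤ quadForm C x' y' / dotp x' y' := by
  rw [payoff, payoff, if_pos hd, if_pos hd'] at h
  exact (ENNReal.ofReal_le_ofReal_iff (div_nonneg (quadForm_nonneg hC hx' hy') hd'.le)).1 h

/-- If `u ≤ v` coordinatewise and the sums of `u` and `v` against a positive weight agree,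
then `u = v`. -/
theorem eq_of_le_of_weighted_sum_eq {ι : Type*} [Fintype ι] {w u v : ι → ℝ}
    (hw : ∀ i, 0 < w i) (h : ∀ i, u i ≤ v i) (hs : ∑ i, w i * u i = ∑ i, w i * v i) :
    u = v := by
  have key := (Finset.sum_eq_sum_iff_of_le
    fun i _ => mul_le_mul_of_nonneg_left (h i) (hw i).le).1 hs
  exact funext fun i => mul_left_cancel₀ (hw i).ne' (key i (Finset.mem_univ i))

theorem stmt6 (n : ℕ) (hn : 1 ≤ n) (A B : Matrix (Fin n) (Fin n) ℝ)
    (hA : ∀ i j, 0 ≤ A i j) (hB : ∀ i j, 0 ≤ B i j)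
    (xs ys : Fin n → ℝ) (hne : IsNash A B xs ys)
    (hxfull : ∀ i, 0 < xs i) (hyfull : ∀ i, 0 < ys i)
    (ρA ρB : ℝ)
    (hρA : ρA = quadForm A xs ys / dotp xs ys)
    (hρB : ρB = quadForm B xs ys / dotp xs ys) :
    B.transpose.mulVec xs = ρB • xs ∧ A.mulVec ys = ρA • ys := by
  obtain ⟨hx, hy, hnA, hnB⟩ := hne
  have hd : 0 < dotp xs ys :=
    Finset.sum_pos (fun i _ => mul_pos (hxfull i) (hyfull i)) ⟨⟨0, hn⟩, Finset.mem_univ _⟩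
  rw [eq_div_iff hd.ne'] at hρA hρB
  constructor
  · refine (eq_of_le_of_weighted_sum_eq hyfull (fun j => ?_) ?_).symm
    · have h := div_le_div_of_payoff_le hB hx.1 (single_mem_simplex j).1 hd
        (by simpa [dotp_single_right] using hxfull j) (hnB _ (single_mem_simplex j))
      rw [quadForm_single_right, dotp_single_right, ← hρB, mul_div_cancel_right₀ _ hd.ne',
        le_div_iff₀ (hxfull j)] at h
      simpa using h
    · rw [quadForm_eq_sum_transpose_mulVec, dotp, Finset.mul_sum] at hρB
      convert hρB using 2
      · simp only [Pi.smul_apply, smul_eq_mul]; ring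
      · ring
  · refine eq_of_le_of_weighted_sum_eq hxfull (fun i => ?_) ?_
    · have h := div_le_div_of_payoff_le hA hx.1 hy.1
        (by rw [dotp_single_left]; exact hyfull i) hd
        (hnA _ (single_mem_simplex i))
      rw [quadForm_single_left, dotp_single_left, ← hρA, mul_div_cancel_right₀ _ hd.ne',
        div_le_iff₀ (hyfull i)] at h
      simpa using h
    · rw [quadForm_eq_sum_mulVec, dotp, Finset.mul_sum] at hρA
      rw [← hρA]
      refine Finset.sum_congr rfl fun i _ => ?_
      simp only [Pi.smul_apply, smul_eq_mul]; ring
end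

section
/- Let n ≥ 2 and let s ∈ ℝ^n satisfy 0 < s_1 ≤ s_2 ≤ … ≤ s_n. Let ρ ∈ [0, ∞) be the unique solution of Σ_{i=1}^n s_i/(ρ + s_i) = 1. Let A be the n×n matrix with A_{i,j} = s_i for i ≠ j and A_{i,i} = 0, and define x*, y* ∈ ℝ^n by x*_i = (1/(n−1))·ρ/(ρ + s_i) and y*_j = s_j/(ρ + s_j). Then x*, y* ∈ Δ_n with all entries strictly positive, Aᵀx* = ρx*, Ay* = ρy*, (x*, y*) is a Nash equilibrium of the SRUC game (A, A), and e^A(x*, y*) = ρ. -/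
open Finset

lemma quadForm_of_mulVec {n : ℕ} {C : Matrix (Fin n) (Fin n) ℝ} {r : ℝ} {y : Fin n → ℝ}
    (h : C.mulVec y = r • y) (x : Fin n → ℝ) : quadForm C x y = r * dotp x y := by
  unfold quadForm dotp
  rw [mul_sum]
  refine sum_congr rfl fun i _ => ?_
  have hi : ∑ j, C i j * y j = r * y i := congrFun h i
  simp_rw [mul_assoc]
  rw [← mul_sum, hi]
  ring

lemma quadForm_of_transpose_mulVec {n : ℕ} {C : Matrix (Fin n) (Fin n) ℝ} {r : ℝ}
    {x : Fin n → ℝ} (h : C.transpose.mulVec x = r • x) (y : Fin n → ℝ) :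
    quadForm C x y = r * dotp x y := by
  unfold quadForm dotp
  rw [mul_sum, sum_comm]
  refine sum_congr rfl fun j _ => ?_
  have hj : ∑ i, C i j * x i = r * x j := congrFun h j
  rw [← sum_mul, ← mul_assoc, ← hj]
  congr 1
  exact sum_congr rfl fun i _ => mul_comm _ _

lemma payoff_of_quadForm {n : ℕ} {C : Matrix (Fin n) (Fin n) ℝ} {r : ℝ} {x y : Fin n → ℝ}
    (h : quadForm C x y = r * dotp x y) (hxy : 0 < dotp x y) :
    payoff C x y = ENNReal.ofReal r := by
  rw [payoff, if_pos hxy, h, mul_div_cancel_right₀ _ hxy.ne']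

lemma dotp_comm {n : ℕ} (x y : Fin n → ℝ) : dotp x y = dotp y x :=
  sum_congr rfl fun _ _ => mul_comm _ _

lemma dotp_pos_of_mem_simplex {n : ℕ} {x y : Fin n → ℝ} (hx : x ∈ simplex n)
    (hy : ∀ i, 0 < y i) : 0 < dotp x y := by
  obtain ⟨i, hi, hxi⟩ : ∃ i ∈ univ, (0 : ℝ) < x i :=
    exists_lt_of_sum_lt (by simp [hx.2])
  exact sum_pos' (fun j _ => mul_nonneg (hx.1 j) (hy j).le) ⟨i, hi, mul_pos hxi (hy i)⟩

theorem stmt15 (n : ℕ) (hn : 2 ≤ n) (s : Fin n → ℝ)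
    (hpos : ∀ i, 0 < s i) (hmono : Monotone s)
    (ρ : ℝ) (hρ0 : 0 ≤ ρ) (hρ : ∑ i, s i / (ρ + s i) = 1)
    (A : Matrix (Fin n) (Fin n) ℝ)
    (hA : ∀ i j, A i j = if i = j then 0 else s i)
    (xs ys : Fin n → ℝ)
    (hx : ∀ i, xs i = (1 / ((n : ℝ) - 1)) * (ρ / (ρ + s i)))
    (hy : ∀ j, ys j = s j / (ρ + s j)) :
    xs ∈ simplex n ∧ ys ∈ simplex n ∧
    (∀ i, 0 < xs i) ∧ (∀ j, 0 < ys j) ∧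
    A.transpose.mulVec xs = ρ • xs ∧ A.mulVec ys = ρ • ys ∧
    IsNash A A xs ys ∧ payoff A xs ys = ENNReal.ofReal ρ := by
  have hn2 : (2 : ℝ) ≤ n := by exact_mod_cast hn
  have hn1 : (n : ℝ) - 1 ≠ 0 := by linarith
  have hρpos : 0 < ρ := by
    refine hρ0.lt_of_ne fun h => ?_
    subst h
    have : ∑ i, s i / (0 + s i) = n := by simp [fun i => (hpos i).ne']
    linarith
  have hd : ∀ i, ρ + s i ≠ 0 := fun i => (add_pos hρpos (hpos i)).ne'
  have hxpos : ∀ i, 0 < xs i := fun i => by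
    rw [hx]
    exact mul_pos (one_div_pos.2 (by linarith)) (div_pos hρpos (add_pos hρpos (hpos i)))
  have hypos : ∀ i, 0 < ys i := fun i => by
    rw [hy]
    exact div_pos (hpos i) (add_pos hρpos (hpos i))
  have hysum : ∑ i, ys i = 1 := by simpa only [hy] using hρ
  have hxy : ∀ i, xs i = (1 / ((n : ℝ) - 1)) * (1 - ys i) := fun i => by
    have := hd i
    rw [hx, hy]
    field_simp
    ring
  have hsx : ∀ i, s i * xs i = (ρ / ((n : ℝ) - 1)) * ys i := fun i => by
    have := hd i
    rw [hx, hy]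
    field_simp
  have hxs : xs ∈ simplex n := by
    refine ⟨fun i => (hxpos i).le, ?_⟩
    simp_rw [hxy]
    rw [← mul_sum, sum_sub_distrib, hysum]
    simp [hn1]
  have hys : ys ∈ simplex n := ⟨fun i => (hypos i).le, hysum⟩
  have hAx : A.transpose.mulVec xs = ρ • xs := by
    funext j
    have : ∀ i, A i j * xs i = s i * xs i - if i = j then s i * xs i else 0 := fun i => by
      rw [hA]
      split_ifs <;> ring
    change ∑ i, A i j * xs i = ρ * xs j
    simp_rw [this]
    rw [sum_sub_distrib, sum_ite_eq' univ j, if_pos (mem_univ j)]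
    simp_rw [hsx]
    rw [← mul_sum, hysum, hxy]
    ring
  have hAy : A.mulVec ys = ρ • ys := by
    funext i
    have : ∀ j, A i j * ys j = s i * ys j - if i = j then s i * ys j else 0 := fun j => by
      rw [hA]
      split_ifs <;> ring
    change ∑ j, A i j * ys j = ρ * ys i
    simp_rw [this]
    rw [sum_sub_distrib, sum_ite_eq univ i, if_pos (mem_univ i), ← mul_sum, hysum, hy]
    have := hd i
    field_simp
    ring
  have hpx : ∀ x ∈ simplex n, payoff A x ys = ENNReal.ofReal ρ := fun x hx' =>
    payoff_of_quadForm (quadForm_of_mulVec hAy x) (dotp_pos_of_mem_simplex hx' hypos)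
  have hpy : ∀ y ∈ simplex n, payoff A xs y = ENNReal.ofReal ρ := fun y hy' =>
    payoff_of_quadForm (quadForm_of_transpose_mulVec hAx y)
      (dotp_comm xs y ▸ dotp_pos_of_mem_simplex hy' hxpos)
  exact ⟨hxs, hys, hxpos, hypos, hAx, hAy,
    ⟨hxs, hys, fun x hx' => by rw [hpx x hx', hpx xs hxs],
      fun y hy' => by rw [hpy y hy', hpy ys hys]⟩, hpx xs hxs⟩
end

section
/- Let n ≥ 1 and let s ∈ ℝ^n satisfy 0 < s_1 ≤ s_2 ≤ … ≤ s_n, and let r := Σ_{i=1}^n s_i. Let A be the (n+1)×(n+1) matrix with A_{i,j} = 0 if i = j, A_{i,j} = s_i if i ≠ j and i ≤ n, and A_{n+1,j} = s_j for j ≤ n. Define x* ∈ ℝ^{n+1} by x*_i = 1/(n+1) for all i, and y* ∈ ℝ^{n+1} by y*_j = s_j/(r + s_j) for j ≤ n and y*_{n+1} = 1 − Σ_{j=1}^n s_j/(r + s_j). Then x*, y* ∈ Δ_{n+1}, Aᵀx* = r·x*, Ay* = r·y*, (x*, y*) is a Nash equilibrium of the SRUC game (A, A), and e^A(x*, y*)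 = r. -/
open Finset

theorem quadForm_of_mulVec_eq {n : ℕ} {C : Matrix (Fin n) (Fin n) ℝ} {y : Fin n → ℝ} {r : ℝ}
    (h : C.mulVec y = r • y) (x : Fin n → ℝ) : quadForm C x y = r * dotp x y := by
  unfold quadForm dotp
  rw [Finset.mul_sum]
  refine Finset.sum_congr rfl fun i _ => ?_
  have hi : ∑ j, C i j * y j = r * y i := congrFun h i
  simp_rw [mul_assoc]
  rw [← Finset.mul_sum, hi]
  ring

theorem quadForm_of_transpose_mulVec_eq {n : ℕ} {C : Matrix (Fin n) (Fin n) ℝ}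
    {x : Fin n → ℝ} {r : ℝ} (h : C.transpose.mulVec x = r • x) (y : Fin n → ℝ) :
    quadForm C x y = r * dotp x y := by
  unfold quadForm dotp
  rw [Finset.sum_comm, Finset.mul_sum]
  refine Finset.sum_congr rfl fun j _ => ?_
  have hj : ∑ i, C i j * x i = r * x j := congrFun h j
  rw [← Finset.sum_mul, ← mul_assoc, ← hj]
  simp_rw [mul_comm]

theorem payoff_eq_of_quadForm_eq {n : ℕ} {C : Matrix (Fin n) (Fin n) ℝ} {x y : Fin n → ℝ}
    {r : ℝ} (h : quadForm C x y = r * dotp x y) (hpos : 0 < dotp x y) :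
    payoff C x y = ENNReal.ofReal r := by
  rw [payoff, if_pos hpos, h, mul_div_cancel_right₀ _ hpos.ne']

theorem dotp_nonneg {n : ℕ} {x y : Fin n → ℝ} (hx : x ∈ simplex n) (hy : y ∈ simplex n) :
    0 ≤ dotp x y :=
  Finset.sum_nonneg fun i _ => mul_nonneg (hx.1 i) (hy.1 i)

theorem payoff_le_of_quadForm_eq {n : ℕ} {C : Matrix (Fin n) (Fin n) ℝ} {x y : Fin n → ℝ}
    {r : ℝ} (h : quadForm C x y = r * dotp x y) (hnonneg : 0 ≤ dotp x y) :
    payoff C x y ≤ ENNReal.ofReal r := by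
  rcases hnonneg.lt_or_eq with hpos | hzero
  · exact (payoff_eq_of_quadForm_eq h hpos).le
  · simp [payoff, h, ← hzero]

theorem stmt16 (n : ℕ) (hn : 1 ≤ n) (s : Fin n → ℝ)
    (hpos : ∀ i, 0 < s i) (hmono : Monotone s)
    (r : ℝ) (hr : r = ∑ i, s i)
    (A : Matrix (Fin (n + 1)) (Fin (n + 1)) ℝ)
    (hA : ∀ i j : Fin (n + 1), A i j =
      if i = j then 0
      else if hi : (i : ℕ) < n then s ⟨i, hi⟩
      else if hj : (j : ℕ) < n then s ⟨j, hj⟩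
      else 0)
    (xs ys : Fin (n + 1) → ℝ)
    (hx : ∀ i, xs i = 1 / ((n : ℝ) + 1))
    (hy : ∀ j : Fin (n + 1), ys j =
      if hj : (j : ℕ) < n then s ⟨j, hj⟩ / (r + s ⟨j, hj⟩)
      else 1 - ∑ k, s k / (r + s k)) :
    xs ∈ simplex (n + 1) ∧ ys ∈ simplex (n + 1) ∧
    A.transpose.mulVec xs = r • xs ∧ A.mulVec ys = r • ys ∧
    IsNash A A xs ys ∧ payoff A xs ys = ENNReal.ofReal r := by
  have hrpos : 0 < r := by
    rw [hr]
    exact Finset.sum_pos (fun i _ => hpos i) ⟨⟨0, hn⟩, Finset.mem_univ _⟩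
  have hden : ∀ k, 0 < r + s k := fun k => add_pos hrpos (hpos k)
  have hne : ∀ k : Fin n, k.castSucc ≠ Fin.last n := fun k => (Fin.castSucc_lt_last k).ne
  have hA_cast : ∀ i j : Fin n, A i.castSucc j.castSucc = if i = j then 0 else s i := by
    intro i j
    simp [hA]
  have hA_cast_last : ∀ i : Fin n, A i.castSucc (Fin.last n) = s i := by
    intro i
    simp [hA, hne]
  have hA_last_cast : ∀ j : Fin n, A (Fin.last n) j.castSucc = s j := by
    intro j
    simp [hA, (hne j).symm]
  have hA_last : A (Fin.last n) (Fin.last n) = 0 := by simp [hA]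
  have hy_cast : ∀ j : Fin n, ys j.castSucc = s j / (r + s j) := by
    intro j
    simp [hy]
  have hy_last : ys (Fin.last n) = 1 - ∑ k, s k / (r + s k) := by simp [hy]
  have hy_sum : ∑ j, ys j = 1 := by
    rw [Fin.sum_univ_castSucc, hy_last]
    simp_rw [hy_cast]
    ring
  have hxs : xs ∈ simplex (n + 1) := by
    refine ⟨fun i => by rw [hx]; positivity, ?_⟩
    simp only [hx, Finset.sum_const, Finset.card_univ, Fintype.card_fin, nsmul_eq_mul]
    push_cast
    field_simp
  have hys : ys ∈ simplex (n + 1) := by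
    refine ⟨fun j => ?_, hy_sum⟩
    refine Fin.lastCases ?_ (fun k => ?_) j
    · rw [hy_last, sub_nonneg]
      calc ∑ k, s k / (r + s k) ≤ ∑ k, s k / r :=
            Finset.sum_le_sum fun k _ =>
              div_le_div_of_nonneg_left (hpos k).le hrpos (le_add_of_nonneg_right (hpos k).le)
        _ = 1 := by rw [← Finset.sum_div, ← hr, div_self hrpos.ne']
    · rw [hy_cast]
      exact div_nonneg (hpos k).le (hden k).le
  have hcol : ∀ j, ∑ i, A i j = r := by
    intro j
    rw [Fin.sum_univ_castSucc]
    refine Fin.lastCases ?_ (fun k => ?_) j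
    · simp [hA_cast_last, hA_last, hr]
    · rw [hA_last_cast, hr, ← Finset.sum_erase_add _ _ (Finset.mem_univ k),
        ← Finset.sum_erase_add _ _ (Finset.mem_univ k)]
      rw [hA_cast, if_pos rfl, add_zero]
      congr 1
      refine Finset.sum_congr rfl fun i hi => ?_
      rw [hA_cast, if_neg (Finset.ne_of_mem_erase hi)]
  have hAx : A.transpose.mulVec xs = r • xs := by
    funext j
    change ∑ i, A i j * xs i = r * xs j
    simp_rw [hx]
    rw [← Finset.sum_mul, hcol]
  have hAy : A.mulVec ys = r • ys := by
    funext i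
    change ∑ j, A i j * ys j = r * ys i
    refine Fin.lastCases ?_ (fun k => ?_) i
    · have hr_last : r * ys (Fin.last n) = ∑ k, (s k - r * (s k / (r + s k))) := by
        rw [hy_last, Finset.sum_sub_distrib, ← hr, ← Finset.mul_sum]
        ring
      rw [hr_last, Fin.sum_univ_castSucc, hA_last, zero_mul, add_zero]
      refine Finset.sum_congr rfl fun j _ => ?_
      rw [hA_last_cast, hy_cast]
      have := (hden j).ne'
      field_simp
      ring
    · have hrow : ∀ j, A k.castSucc j * ys j =
          s k * ys j - if j = k.castSucc then s k * ys j else 0 := by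
        intro j
        by_cases h : j = k.castSucc
        · simp [h, hA_cast]
        · simp [hA, h, Ne.symm h]
      simp_rw [hrow]
      rw [Finset.sum_sub_distrib, ← Finset.mul_sum, hy_sum, Finset.sum_ite_eq' Finset.univ,
        if_pos (Finset.mem_univ _), hy_cast]
      have := (hden k).ne'
      field_simp
      ring
  have hdot : ∀ y ∈ simplex (n + 1), 0 < dotp xs y := by
    intro y hmem
    unfold dotp
    simp_rw [hx]
    rw [← Finset.mul_sum, hmem.2]
    positivity
  have hval : ∀ y ∈ simplex (n + 1), payoff A xs y = ENNReal.ofReal r := fun y hmem =>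
    payoff_eq_of_quadForm_eq (quadForm_of_transpose_mulVec_eq hAx y) (hdot y hmem)
  refine ⟨hxs, hys, hAx, hAy, ⟨hxs, hys, fun x hmem => ?_, fun y hmem => ?_⟩, hval ys hys⟩
  · rw [hval ys hys]
    exact payoff_le_of_quadForm_eq (quadForm_of_mulVec_eq hAy x) (dotp_nonneg hmem hys)
  · rw [hval ys hys, hval y hmem]
end

section
/- Let n ≥ 1, let A and B be nonnegative n×n real matrices with graph(A) a subgraph of graph(B), and let (x*, y*) be a Nash equilibrium of the SRUC game (A, B). Then both e^A(x*, y*) and e^B(x*, y*) are finite (i.e., not equal to ∞). Moreover, if every column of A contains a positive entry, then e^A(x*, y*) > 0. -/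
open Finset

theorem exists_pos_of_mem_simplex {n : ℕ} {x : Fin n → ℝ} (hx : x ∈ simplex n) :
    ∃ i, 0 < x i := by
  obtain ⟨i, -, hi⟩ := Finset.exists_lt_of_sum_lt (s := Finset.univ) (f := fun _ => (0 : ℝ))
    (g := x) (by simp [hx.2])
  exact ⟨i, hi⟩

theorem dotp_pos {n : ℕ} {x y : Fin n → ℝ} (hx : ∀ i, 0 ≤ x i) (hy : ∀ i, 0 ≤ y i)
    {i : Fin n} (hxi : 0 < x i) (hyi : 0 < y i) : 0 < dotp x y :=
  Finset.sum_pos' (fun k _ => mul_nonneg (hx k) (hy k))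
    ⟨i, Finset.mem_univ i, mul_pos hxi hyi⟩

theorem quadForm_pos_iff {n : ℕ} {C : Matrix (Fin n) (Fin n) ℝ} (hC : ∀ i j, 0 ≤ C i j)
    {x y : Fin n → ℝ} (hx : ∀ i, 0 ≤ x i) (hy : ∀ i, 0 ≤ y i) :
    0 < quadForm C x y ↔ ∃ i j, 0 < x i ∧ 0 < C i j ∧ 0 < y j := by
  have hterm : ∀ i j, 0 ≤ x i * C i j * y j := fun i j =>
    mul_nonneg (mul_nonneg (hx i) (hC i j)) (hy j)
  constructor
  · intro h
    by_contra! hzero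
    refine h.ne' (Finset.sum_eq_zero fun i _ => Finset.sum_eq_zero fun j _ => ?_)
    rcases (hx i).eq_or_lt with hxi | hxi
    · simp [← hxi]
    rcases (hC i j).eq_or_lt with hCij | hCij
    · simp [← hCij]
    · simp [le_antisymm (hzero i j hxi hCij) (hy j)]
  · rintro ⟨i, j, hxi, hCij, hyj⟩
    exact Finset.sum_pos' (fun k _ => Finset.sum_nonneg fun l _ => hterm k l)
      ⟨i, Finset.mem_univ i, Finset.sum_pos' (fun l _ => hterm i l)
        ⟨j, Finset.mem_univ j, mul_pos (mul_pos hxi hCij) hyj⟩⟩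

theorem payoff_ne_top_of_dotp_pos {n : ℕ} (C : Matrix (Fin n) (Fin n) ℝ) {x y : Fin n → ℝ}
    (h : 0 < dotp x y) : payoff C x y ≠ ⊤ := by
  simp [payoff, h]

theorem payoff_pos_of_quadForm_pos {n : ℕ} {C : Matrix (Fin n) (Fin n) ℝ} {x y : Fin n → ℝ}
    (h : 0 < quadForm C x y) : 0 < payoff C x y := by
  unfold payoff
  split_ifs with hd
  · exact ENNReal.ofReal_pos.2 (div_pos h hd)
  · exact ENNReal.zero_lt_top

/-- If the graph of `A` is a subgraph of the graph of `B`, an infinite payoff for `A` forces an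
infinite payoff for `B`. -/
theorem payoff_eq_top_of_subgraph {n : ℕ} {A B : Matrix (Fin n) (Fin n) ℝ}
    (hA : ∀ i j, 0 ≤ A i j) (hB : ∀ i j, 0 ≤ B i j)
    (hsub : ∀ i j : Fin n, i ≠ j → 0 < A i j → 0 < B i j) {x y : Fin n → ℝ}
    (hx : ∀ i, 0 ≤ x i) (hy : ∀ i, 0 ≤ y i) (h : payoff A x y = ⊤) : payoff B x y = ⊤ := by
  have hd : ¬ 0 < dotp x y := fun hd => payoff_ne_top_of_dotp_pos A hd h
  have hqA : 0 < quadForm A x y := by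
    by_contra hq
    simp [payoff, hd, hq] at h
  obtain ⟨i, j, hxi, hAij, hyj⟩ := (quadForm_pos_iff hA hx hy).1 hqA
  have hij : i ≠ j := by
    rintro rfl
    exact hd (dotp_pos hx hy hxi hyj)
  have hqB : 0 < quadForm B x y :=
    (quadForm_pos_iff hB hx hy).2 ⟨i, j, hxi, hsub i j hij hAij, hyj⟩
  simp [payoff, hd, hqB]

theorem stmt18 (n : ℕ) (hn : 1 ≤ n) (A B : Matrix (Fin n) (Fin n) ℝ)
    (hA : ∀ i j, 0 ≤ A i j) (hB : ∀ i j, 0 ≤ B i j)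
    (hsub : ∀ i j : Fin n, i ≠ j → 0 < A i j → 0 < B i j)
    (xs ys : Fin n → ℝ) (hne : IsNash A B xs ys) :
    payoff A xs ys ≠ ⊤ ∧ payoff B xs ys ≠ ⊤ ∧
    ((∀ j, ∃ i, 0 < A i j) → 0 < payoff A xs ys) := by
  obtain ⟨hxs, hys, hmax, hmin⟩ := hne
  have hBfin : payoff B xs ys ≠ ⊤ := by
    obtain ⟨i, hi⟩ := exists_pos_of_mem_simplex hxs
    exact ne_top_of_le_ne_top (payoff_ne_top_of_dotp_pos B (dotp_pos hxs.1 hxs.1 hi hi))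
      (hmin xs hxs)
  refine ⟨fun h => hBfin (payoff_eq_top_of_subgraph hA hB hsub hxs.1 hys.1 h), hBfin, ?_⟩
  intro hcol
  obtain ⟨j, hj⟩ := exists_pos_of_mem_simplex hys
  obtain ⟨i, hij⟩ := hcol j
  have hmem : Pi.single i (1 : ℝ) ∈ simplex n :=
    ⟨fun k => (Pi.single_nonneg.2 zero_le_one : (0 : Fin n → ℝ) ≤ Pi.single i 1) k, by simp⟩
  exact (payoff_pos_of_quadForm_pos ((quadForm_pos_iff hA hmem.1 hys.1).2
    ⟨i, j, by simp, hij, hj⟩)).trans_le (hmax _ hmem)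
end
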